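/- arXiv:2405.06689 — 2 statements merged into one kernel-verified Lean document; each statement's English description precedes it below -/
import Mathlib

section
/- Consider an SSG with the one-step Stackelberg operator T, the maps R_A(s,v) (assumed nonempty) and R_B(s,f_s,v_B) (assumed a singleton) as in the fixed-point characterization. Suppose V = (V_A, V_B) is a fixed point of T. Define the fixed-point-equilibrium policies f̄ and ḡ by f̄(s) ∈ R_A(s, V) and ḡ(s) = R_B(s, f̄(s), V_B) for each s ∈ S. Then V_A^{f̄ḡ}(s) = V_A(s) and V_B^{f̄ḡ}(s) = V_B(s) for all s ∈ S, and ḡ is a best response to f̄, i.e., V_B^{f̄ḡ}(s) = max over all follower policies g of V_B^{f̄g}(s) for all s ∈ S. -/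
open Finset

/-- A probability distribution on a finite type, represented as a function. -/
def IsDist {α : Type*} [Fintype α] (d : α → ℝ) : Prop :=
  (∀ x, 0 ≤ d x) ∧ ∑ x, d x = 1

/-- A (stationary stochastic) policy: a distribution over actions at each state. -/
def IsPol {S α : Type*} [Fintype α] (f : S → α → ℝ) : Prop :=
  ∀ s, IsDist (f s)

/-- A deterministic policy viewed as a stochastic one. -/
noncomputable def det {S α : Type*} [DecidableEq α] (g : S → α) : S → α → ℝ :=
  fun s a => if a = g s then 1 else 0

/-- `V` is the value function of the policy pair `(f, g)` for reward `r`,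
discount `γ` and transition kernel `p`, i.e. `V` satisfies the Bellman
expectation equation (whose solution is unique since `γ < 1`). -/
def IsValue {S A B : Type*} [Fintype S] [Fintype A] [Fintype B]
    (p : S → A → B → S → ℝ) (r : S → A → B → ℝ) (γ : ℝ)
    (f : S → A → ℝ) (g : S → B → ℝ) (V : S → ℝ) : Prop :=
  ∀ s, V s = ∑ a, ∑ b, f s a * g s b * (r s a b + γ * ∑ s', p s a b s' * V s')

/-- Weak dominance `v ≽ w`. -/
def DomGE {S : Type*} (v w : S → ℝ) : Prop := ∀ s, w s ≤ v s

/-- Strict dominance `v ≻ w`. -/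
def SDom {S : Type*} (v w : S → ℝ) : Prop := DomGE v w ∧ v ≠ w

/-- A two-player stochastic Stackelberg game together with its value functions:
finite state/action spaces, transition kernel, bounded rewards, discount rates
in `[0,1)`, and for every pair of (stochastic) policies the associated value
functions `VA`, `VB`, characterized as the (unique) solutions of the Bellman
expectation equations. -/
structure SSGVal (S A B : Type*) [Fintype S] [Fintype A] [Fintype B] where
  p : S → A → B → S → ℝ
  hp : ∀ s a b, IsDist (p s a b)
  rA : S → A → B → ℝ
  rB : S → A → B → ℝ
  gA : ℝ
  gB : ℝ
  hgA0 : 0 ≤ gA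
  hgA1 : gA < 1
  hgB0 : 0 ≤ gB
  hgB1 : gB < 1
  VA : (S → A → ℝ) → (S → B → ℝ) → S → ℝ
  VB : (S → A → ℝ) → (S → B → ℝ) → S → ℝ
  hVA : ∀ f g, IsPol f → IsPol g → IsValue p rA gA f g (VA f g)
  hVB : ∀ f g, IsPol f → IsPol g → IsValue p rB gB f g (VB f g)

/-- Follower's one-step payoff `r_B(s,f_s,b) + γ_B Σ_{s'} p(s'|s,f_s,b) v_B(s')`. -/
def qB {S A B : Type*} [Fintype S] [Fintype A] [Fintype B]
    (M : SSGVal S A B) (vB : S → ℝ) (s : S) (fs : A → ℝ) (b : B) : ℝ :=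
  (∑ a, fs a * M.rB s a b) + M.gB * ∑ s', (∑ a, fs a * M.p s a b s') * vB s'

/-- Leader's one-step payoff under the follower's reaction `RB`. -/
def qA {S A B : Type*} [Fintype S] [Fintype A] [Fintype B]
    (M : SSGVal S A B) (vA : S → ℝ) (RB : S → (A → ℝ) → B) (s : S) (fs : A → ℝ) : ℝ :=
  (∑ a, fs a * M.rA s a (RB s fs)) + M.gA * ∑ s', (∑ a, fs a * M.p s a (RB s fs) s') * vA s'

/-- Comparison principle for the Bellman expectation operator. -/
theorem bellman_cmp {S A B : Type*} [Fintype S] [Fintype A] [Fintype B] [Nonempty S]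
    (p : S → A → B → S → ℝ) (hp : ∀ s a b, IsDist (p s a b)) (r : S → A → B → ℝ) (γ : ℝ)
    (h0 : 0 ≤ γ) (h1 : γ < 1) (f : S → A → ℝ) (g : S → B → ℝ) (hf : IsPol f) (hg : IsPol g)
    (V W : S → ℝ)
    (hV : ∀ s, V s ≤ ∑ a, ∑ b, f s a * g s b * (r s a b + γ * ∑ s', p s a b s' * V s'))
    (hW : ∀ s, ∑ a, ∑ b, f s a * g s b * (r s a b + γ * ∑ s', p s a b s' * W s') ≤ W s) :
    ∀ s, V s ≤ W s := by
  obtain ⟨t, ht⟩ := Finite.exists_max (fun s => V s - W s)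
  have key : ∀ a b, f t a * g t b * (r t a b + γ * ∑ s', p t a b s' * V s')
      ≤ f t a * g t b * (r t a b + γ * ∑ s', p t a b s' * W s')
        + f t a * g t b * (γ * (V t - W t)) := by
    intro a b
    have e : ∑ s', p t a b s' * V s' ≤ ∑ s', p t a b s' * W s' + (V t - W t) := by
      have : ∑ s', p t a b s' * V s' ≤ ∑ s', (p t a b s' * W s' + p t a b s' * (V t - W t)) := by
        apply Finset.sum_le_sum
        intro s' _
        have := mul_le_mul_of_nonneg_left (ht s') ((hp t a b).1 s')
        linarith
      rw [Finset.sum_add_distrib, ← Finset.sum_mul, (hp t a b).2, one_mul] at this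
      exact this
    rw [← mul_add]
    apply mul_le_mul_of_nonneg_left _ (mul_nonneg ((hf t).1 a) ((hg t).1 b))
    have := mul_le_mul_of_nonneg_left e h0
    linarith
  have h2 := Finset.sum_le_sum (fun a (_ : a ∈ Finset.univ) =>
    Finset.sum_le_sum (fun b (_ : b ∈ Finset.univ) => key a b))
  simp only [Finset.sum_add_distrib, ← Finset.sum_mul, ← Finset.mul_sum] at h2
  rw [(hg t).2] at h2
  simp only [mul_one] at h2
  rw [(hf t).2, one_mul] at h2
  have h3 := hV t
  have h4 := hW t
  have h5 : V t - W t ≤ γ * (V t - W t) := by linarith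
  have h6 : V t - W t ≤ 0 := by nlinarith
  intro s
  have := ht s
  linarith

theorem bellman_swap {S A B : Type*} [Fintype S] [Fintype A] [Fintype B]
    (p : A → B → S → ℝ) (r : A → B → ℝ) (γ : ℝ) (f : A → ℝ) (g : B → ℝ) (V : S → ℝ) :
    ∑ a, ∑ b, f a * g b * (r a b + γ * ∑ s', p a b s' * V s')
      = ∑ b, g b * ((∑ a, f a * r a b) + γ * ∑ s', (∑ a, f a * p a b s') * V s') := by
  rw [Finset.sum_comm]
  apply Finset.sum_congr rfl
  intro b _
  have : ∑ s', (∑ a, f a * p a b s') * V s' = ∑ a, f a * ∑ s', p a b s' * V s' := by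
    simp only [Finset.sum_mul, Finset.mul_sum]
    rw [Finset.sum_comm]
    simp only [mul_assoc]
  rw [this, Finset.mul_sum, ← Finset.sum_add_distrib, Finset.mul_sum]
  apply Finset.sum_congr rfl
  intro a _
  ring

theorem det_isPol {S B : Type*} [Fintype B] [DecidableEq B] (g : S → B) : IsPol (det g) := by
  intro s
  constructor
  · intro b
    unfold det
    split_ifs <;> norm_num
  · simp [det]

theorem stmt3 {S A B : Type*} [Fintype S] [Fintype A] [Fintype B]
    [Nonempty S] [Nonempty A] [Nonempty B] [DecidableEq B]
    (M : SSGVal S A B) (VA0 VB0 : S → ℝ)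
    (RB : S → (A → ℝ) → B)
    (hRB : ∀ s fs, IsDist fs → ∀ b, qB M VB0 s fs b ≤ qB M VB0 s fs (RB s fs))
    (hRBu : ∀ s fs, IsDist fs → ∀ b,
      (∀ b', qB M VB0 s fs b' ≤ qB M VB0 s fs b) → b = RB s fs)
    (fstar : S → A → ℝ) (hfstarPol : IsPol fstar)
    (hfstar : ∀ s fs, IsDist fs → qA M VA0 RB s fs ≤ qA M VA0 RB s (fstar s))
    (hfixA : ∀ s, VA0 s = qA M VA0 RB s (fstar s))
    (hfixB : ∀ s, VB0 s = qB M VB0 s (fstar s) (RB s (fstar s))) :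
    (∀ s, M.VA fstar (det (fun s' => RB s' (fstar s'))) s = VA0 s) ∧
    (∀ s, M.VB fstar (det (fun s' => RB s' (fstar s'))) s = VB0 s) ∧
    (∀ g, IsPol g → ∀ s,
      M.VB fstar g s ≤ M.VB fstar (det (fun s' => RB s' (fstar s'))) s) := by
  have hd := det_isPol (fun s' => RB s' (fstar s'))
  have eA : IsValue M.p M.rA M.gA fstar (det (fun s' => RB s' (fstar s'))) VA0 := by
    intro s
    rw [bellman_swap, hfixA s]
    simp [det, qA]
  have eB : IsValue M.p M.rB M.gB fstar (det (fun s' => RB s' (fstar s'))) VB0 := by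
    intro s
    rw [bellman_swap, hfixB s]
    simp [det, qB]
  have vA := M.hVA _ _ hfstarPol hd
  have vB := M.hVB _ _ hfstarPol hd
  have hB : ∀ s, M.VB fstar (det (fun s' => RB s' (fstar s'))) s = VB0 s := fun s => le_antisymm
    (bellman_cmp M.p M.hp M.rB M.gB M.hgB0 M.hgB1 _ _ hfstarPol hd _ _
      (fun s => (vB s).le) (fun s => (eB s).ge) s)
    (bellman_cmp M.p M.hp M.rB M.gB M.hgB0 M.hgB1 _ _ hfstarPol hd _ _
      (fun s => (eB s).le) (fun s => (vB s).ge) s)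
  refine ⟨fun s => le_antisymm
    (bellman_cmp M.p M.hp M.rA M.gA M.hgA0 M.hgA1 _ _ hfstarPol hd _ _
      (fun s => (vA s).le) (fun s => (eA s).ge) s)
    (bellman_cmp M.p M.hp M.rA M.gA M.hgA0 M.hgA1 _ _ hfstarPol hd _ _
      (fun s => (eA s).le) (fun s => (vA s).ge) s), hB, ?_⟩
  intro g hg s
  rw [hB s]
  refine bellman_cmp M.p M.hp M.rB M.gB M.hgB0 M.hgB1 _ _ hfstarPol hg _ _
      (fun s => (M.hVB _ _ hfstarPol hg s).le) (fun s => ?_) s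
  rw [bellman_swap]
  calc _ ≤ ∑ b, g s b * VB0 s := by
        apply Finset.sum_le_sum
        intro b _
        apply mul_le_mul_of_nonneg_left _ ((hg s).1 b)
        rw [hfixB s]
        exact hRB s _ (hfstarPol s) b
    _ = VB0 s := by rw [← Finset.sum_mul, (hg s).2, one_mul]
end

section
/- Consider an SSG with the best-response follower. A leader policy f' is a Pareto-optimal policy (i.e., V_A^{f'†} ∈ 𝒫𝒱) if for every leader policy f at least one of the following holds: (i) Q_A^{f'†}(s, f) = V_A^{f'†}(s) for all s ∈ S; or (ii) there exists s ∈ S with Q_A^{f'†}(s, f) < V_A^{f'†}(s) − (γ_A / (1 − γ_A)) · δ(f, f'), where δ(f, f') := max_{s∈S} Σ_{s'} p(s'|s, f(s), R_B^*(s,f)) ( Q_A^{f'†}(s', f) − V_A^{f'†}(s') ). -/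
open Finset

/-- An SSG with a best-response follower: `Rstar f` is the unique deterministic
best response of the follower to the leader policy `f`. -/
structure Setup (S A B : Type*) [Fintype S] [Fintype A] [Fintype B] [DecidableEq B]
    extends SSGVal S A B where
  Rstar : (S → A → ℝ) → S → B
  hRstar : ∀ f, IsPol f → ∀ g, IsPol g → ∀ s, VB f g s ≤ VB f (det (Rstar f)) s
  hRstarU : ∀ f, IsPol f → ∀ h : S → B,
      (∀ g, IsPol g → ∀ s, VB f g s ≤ VB f (det h) s) → h = Rstar f

namespace Setup

variable {S A B : Type*} [Fintype S] [Fintype A] [Fintype B] [DecidableEq B]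

/-- `V_A^{f†}`: the leader's value under the best-response follower. -/
noncomputable def VAdag (M : Setup S A B) (f : S → A → ℝ) : S → ℝ :=
  M.VA f (det (M.Rstar f))

/-- Marginalized leader reward `r_A(s, f(s), b)`. -/
def rAf (M : Setup S A B) (f : S → A → ℝ) (s : S) (b : B) : ℝ :=
  ∑ a, f s a * M.rA s a b

/-- Marginalized transition `p(s' | s, f(s), b)`. -/
def pf (M : Setup S A B) (f : S → A → ℝ) (s : S) (b : B) (s' : S) : ℝ :=
  ∑ a, f s a * M.p s a b s'

/-- `Q_A^{f'†}(s, f)`. -/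
noncomputable def Q (M : Setup S A B) (f' f : S → A → ℝ) (s : S) : ℝ :=
  M.rAf f s (M.Rstar f s) + M.gA * ∑ s', M.pf f s (M.Rstar f s) s' * M.VAdag f' s'

/-- `𝒱`: the set of reachable leader value functions under the best-response follower. -/
def Vset (M : Setup S A B) : Set (S → ℝ) := {v | ∃ f, IsPol f ∧ v = M.VAdag f}

/-- `𝒫𝒱`: the set of Pareto-optimal value functions in `cl 𝒱`. -/
def PV (M : Setup S A B) : Set (S → ℝ) :=
  {v | v ∈ closure M.Vset ∧ ¬ ∃ w ∈ closure M.Vset, SDom w v}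

/-- `W_≽(f')`: policies satisfying the policy-improvement condition from `f'`. -/
noncomputable def Wge (M : Setup S A B) (f' : S → A → ℝ) : Set (S → A → ℝ) :=
  {f | IsPol f ∧ ∀ s, M.VAdag f' s ≤ M.Q f' f s}

/-- `W_{1-ε}(f')`: ε-optimal improving policies for the scalarization `L`. -/
noncomputable def Weps (M : Setup S A B) (L : (S → ℝ) → ℝ) (ε : ℝ) (f' : S → A → ℝ) :
    Set (S → A → ℝ) :=
  {f | f ∈ M.Wge f' ∧
    (1 - ε) * sSup ((fun h => L (M.Q f' h) - L (M.VAdag f')) '' M.Wge f')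
      ≤ L (M.Q f' f) - L (M.VAdag f')}

end Setup


section Helpers

variable {S A B : Type*} [Fintype S] [Fintype A] [Fintype B]

lemma maxPrinciple [Nonempty S] (P : S → S → ℝ) (hP : ∀ s, IsDist (P s)) (γ c : ℝ)
    (h0 : 0 ≤ γ) (h1 : γ < 1) (D : S → ℝ) (hD : ∀ s, D s ≤ c + γ * ∑ s', P s s' * D s') (s : S) :
    D s ≤ c / (1 - γ) := by
  obtain ⟨m, hm⟩ := Finite.exists_max D
  have h2 : ∑ s', P m s' * D s' ≤ D m := by
    calc ∑ s', P m s' * D s' ≤ ∑ s', P m s' * D m :=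
          Finset.sum_le_sum fun s' _ => mul_le_mul_of_nonneg_left (hm s') ((hP m).1 s')
      _ = D m := by rw [← Finset.sum_mul, (hP m).2, one_mul]
  have h3 := hD m
  have h4 := mul_le_mul_of_nonneg_left h2 h0
  refine (hm s).trans ?_
  rw [le_div_iff₀ (by linarith)]
  nlinarith

/-- The Bellman operator. -/
noncomputable def bellT (p : S → A → B → S → ℝ) (r : S → A → B → ℝ) (γ : ℝ)
    (f : S → A → ℝ) (g : S → B → ℝ) (V : S → ℝ) (s : S) : ℝ :=
  ∑ a, ∑ b, f s a * g s b * (r s a b + γ * ∑ s', p s a b s' * V s')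

/-- The induced transition matrix. -/
noncomputable def kerP (p : S → A → B → S → ℝ) (f : S → A → ℝ) (g : S → B → ℝ) (s s' : S) : ℝ :=
  ∑ a, ∑ b, f s a * g s b * p s a b s'

lemma kerP_dist (p : S → A → B → S → ℝ) (hp : ∀ s a b, IsDist (p s a b))
    (f : S → A → ℝ) (g : S → B → ℝ) (hf : IsPol f) (hg : IsPol g) (s : S) :
    IsDist (kerP p f g s) := by
  constructor
  · intro s'
    exact Finset.sum_nonneg fun a _ => Finset.sum_nonneg fun b _ =>
      mul_nonneg (mul_nonneg ((hf s).1 a) ((hg s).1 b)) ((hp s a b).1 s')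
  · unfold kerP
    rw [Finset.sum_comm]
    have : ∀ a, ∑ s', ∑ b, f s a * g s b * p s a b s' = f s a := by
      intro a
      rw [Finset.sum_comm]
      simp_rw [← Finset.mul_sum, (hp s a _).2, mul_one, ← Finset.mul_sum, (hg s).2, mul_one]
    simp_rw [this]
    exact (hf s).2

lemma bellT_sub (p : S → A → B → S → ℝ) (r : S → A → B → ℝ) (γ : ℝ)
    (f : S → A → ℝ) (g : S → B → ℝ) (V U : S → ℝ) (s : S) :
    bellT p r γ f g V s - bellT p r γ f g U s = γ * ∑ s', kerP p f g s s' * (V s' - U s') := by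
  have : ∑ s', kerP p f g s s' * (V s' - U s')
      = ∑ a, ∑ b, f s a * g s b * ∑ s', p s a b s' * (V s' - U s') := by
    unfold kerP
    simp_rw [Finset.sum_mul, Finset.mul_sum]
    rw [Finset.sum_comm]
    refine Finset.sum_congr rfl fun a _ => ?_
    rw [Finset.sum_comm]
    simp_rw [mul_assoc]
  rw [this]
  unfold bellT
  rw [Finset.mul_sum, ← Finset.sum_sub_distrib]
  refine Finset.sum_congr rfl fun a _ => ?_
  rw [Finset.mul_sum, ← Finset.sum_sub_distrib]
  refine Finset.sum_congr rfl fun b _ => ?_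
  simp_rw [mul_sub, Finset.sum_sub_distrib]
  ring

lemma value_est [Nonempty S] (p : S → A → B → S → ℝ) (hp : ∀ s a b, IsDist (p s a b))
    (r : S → A → B → ℝ) (γ : ℝ) (h0 : 0 ≤ γ) (h1 : γ < 1)
    (f : S → A → ℝ) (g : S → B → ℝ) (hf : IsPol f) (hg : IsPol g) (V U : S → ℝ)
    (hV : IsValue p r γ f g V) :
    dist V U ≤ dist (bellT p r γ f g U) U / (1 - γ) := by
  have hd : ∀ s, |bellT p r γ f g U s - U s| ≤ dist (bellT p r γ f g U) U := fun s => by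
    rw [← Real.dist_eq]; exact dist_le_pi_dist _ _ s
  have hV' : ∀ s, V s = bellT p r γ f g V s := hV
  have hk := kerP_dist p hp f g hf hg
  rw [dist_pi_le_iff (div_nonneg dist_nonneg (by linarith))]
  intro s
  rw [Real.dist_eq, abs_le']
  constructor
  · refine maxPrinciple (kerP p f g) hk γ _ h0 h1 (fun s => V s - U s) (fun s => ?_) s
    have := (abs_le.1 (hd s)).2
    have h2 := bellT_sub p r γ f g V U s
    have h3 := hV' s
    linarith
  · rw [neg_sub]
    refine maxPrinciple (kerP p f g) hk γ _ h0 h1 (fun s => U s - V s) (fun s => ?_) s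
    have := (abs_le.1 (hd s)).1
    have h2 := bellT_sub p r γ f g U V s
    have h3 := hV' s
    linarith

lemma value_cont [Nonempty S] (p : S → A → B → S → ℝ) (hp : ∀ s a b, IsDist (p s a b))
    (r : S → A → B → ℝ) (γ : ℝ) (h0 : 0 ≤ γ) (h1 : γ < 1)
    (g : S → B → ℝ) (hg : IsPol g) (V : (S → A → ℝ) → S → ℝ)
    (hV : ∀ f, IsPol f → IsValue p r γ f g (V f)) :
    ContinuousOn V {f | IsPol f} := by
  intro f₀ hf₀
  have hc : Continuous fun f => dist (bellT p r γ f g (V f₀)) (V f₀) / (1 - γ) := by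
    unfold bellT
    fun_prop
  have h2 := hc.tendsto f₀
  have h3 : bellT p r γ f₀ g (V f₀) = V f₀ := funext fun s => (hV f₀ hf₀ s).symm
  rw [h3, dist_self, zero_div] at h2
  rw [ContinuousWithinAt, tendsto_iff_dist_tendsto_zero]
  refine squeeze_zero' (Filter.Eventually.of_forall fun _ => dist_nonneg) ?_
    (h2.mono_left nhdsWithin_le_nhds)
  filter_upwards [self_mem_nhdsWithin] with f hf
  exact value_est p hp r γ h0 h1 f g hf hg _ _ (hV f hf)

lemma isCompact_pol : IsCompact {f : S → A → ℝ | IsPol f} := by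
  have : {f : S → A → ℝ | IsPol f} = Set.univ.pi fun _ => stdSimplex ℝ A := by
    ext f
    simp [IsPol, IsDist, stdSimplex]
  rw [this]
  exact isCompact_univ_pi fun _ => isCompact_stdSimplex ℝ A

lemma det_pol [DecidableEq B] (g : S → B) : IsPol (det g) := by
  intro s
  constructor
  · intro b
    unfold det
    split_ifs <;> norm_num
  · simp [det]

lemma Vset_closed [Nonempty S] [DecidableEq B] (M : Setup S A B) : IsClosed M.Vset := by
  have hB : ∀ g, IsPol g → ContinuousOn (fun f => M.VB f g) {f | IsPol f} := fun g hg =>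
    value_cont M.p M.hp M.rB M.gB M.hgB0 M.hgB1 g hg _ fun f hf => M.hVB f g hf hg
  have hA : ∀ g, IsPol g → ContinuousOn (fun f => M.VA f g) {f | IsPol f} := fun g hg =>
    value_cont M.p M.hp M.rA M.gA M.hgA0 M.hgA1 g hg _ fun f hf => M.hVA f g hf hg
  have hKc : IsClosed {f : S → A → ℝ | IsPol f} := isCompact_pol.isClosed
  let K : (S → B) → Set (S → A → ℝ) := fun g => {f | IsPol f ∧ M.Rstar f = g}
  have hK : ∀ g, IsCompact (K g) := by
    intro g
    have hEq : K g = {f | IsPol f} ∩ ⋂ (g' : {g' : S → B → ℝ // IsPol g'}) (s : S),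
        {f | f ∈ {f | IsPol f} ∧ M.VB f g' s ≤ M.VB f (det g) s} := by
      ext f
      simp only [K, Set.mem_ofPred_eq, Set.mem_inter_iff, Set.mem_iInter]
      constructor
      · rintro ⟨hf, rfl⟩
        exact ⟨hf, fun g' s => ⟨hf, M.hRstar f hf g' g'.2 s⟩⟩
      · rintro ⟨hf, h⟩
        exact ⟨hf, (M.hRstarU f hf g fun g' hg' s => (h ⟨g', hg'⟩ s).2).symm⟩
    rw [hEq]
    refine isCompact_pol.inter_right (isClosed_iInter fun g' => isClosed_iInter fun s => ?_)
    exact hKc.isClosed_le ((continuous_apply s).comp_continuousOn (hB g' g'.2))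
      ((continuous_apply s).comp_continuousOn (hB _ (det_pol g)))
  have hV : M.Vset = ⋃ g, (fun f => M.VA f (det g)) '' K g := by
    ext v
    simp only [Setup.Vset, Set.mem_ofPred_eq, Set.mem_iUnion, Set.mem_image, K, Setup.VAdag]
    constructor
    · rintro ⟨f, hf, rfl⟩
      exact ⟨_, f, ⟨hf, rfl⟩, rfl⟩
    · rintro ⟨g, f, ⟨hf, rfl⟩, rfl⟩
      exact ⟨f, hf, rfl⟩
  rw [hV]
  exact isClosed_iUnion_of_finite fun g =>
    ((hK g).image_of_continuousOn ((hA _ (det_pol g)).mono fun f hf => hf.1)).isClosed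

end Helpers

theorem stmt14 {S A B : Type*} [Fintype S] [Fintype A] [Fintype B]
    [Nonempty S] [Nonempty A] [Nonempty B] [DecidableEq B]
    (M : Setup S A B)
    (f' : S → A → ℝ) (hf' : IsPol f')
    (h : ∀ f, IsPol f →
      (∀ s, M.Q f' f s = M.VAdag f' s) ∨
      (∃ s, M.Q f' f s < M.VAdag f' s - M.gA / (1 - M.gA) *
        (⨆ s₀, ∑ s', M.pf f s₀ (M.Rstar f s₀) s' * (M.Q f' f s' - M.VAdag f' s')))) :
    M.VAdag f' ∈ M.PV := by
  refine ⟨subset_closure ⟨f', hf', rfl⟩, ?_⟩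
  rw [(Vset_closed M).closure_eq]
  rintro ⟨w, ⟨f, hf, rfl⟩, hdom, hne⟩
  have hg := det_pol (M.Rstar f)
  set g := det (M.Rstar f) with hgdef
  set P : S → S → ℝ := fun s => M.pf f s (M.Rstar f s) with hPdef
  have hPk : P = kerP M.p f g := by
    funext s s'
    simp [hPdef, Setup.pf, kerP, hgdef, det]
  have hP : ∀ s, IsDist (P s) := by
    rw [hPk]
    exact kerP_dist M.p M.hp f g hf hg
  have hQ : ∀ s, M.Q f' f s = bellT M.p M.rA M.gA f g (M.VAdag f') s := by
    intro s
    have h1 : ∀ U : S → ℝ, bellT M.p M.rA M.gA f g U s =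
        ∑ a, f s a * (M.rA s a (M.Rstar f s) + M.gA * ∑ s', M.p s a (M.Rstar f s) s' * U s') := by
      intro U
      simp [bellT, hgdef, det]
    rw [h1]
    unfold Setup.Q Setup.rAf Setup.pf
    simp_rw [mul_add, Finset.sum_add_distrib, Finset.sum_mul, Finset.mul_sum]
    congr 1
    rw [Finset.sum_comm]
    refine Finset.sum_congr rfl fun a _ => Finset.sum_congr rfl fun s' _ => by ring
  set q : S → ℝ := fun s => M.Q f' f s - M.VAdag f' s with hq
  set D : S → ℝ := fun s => M.VAdag f s - M.VAdag f' s with hDdef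
  have hD : ∀ s, D s = q s + M.gA * ∑ s', P s s' * D s' := by
    intro s
    have h2 := bellT_sub M.p M.rA M.gA f g (M.VAdag f) (M.VAdag f') s
    have h3 : M.VAdag f s = bellT M.p M.rA M.gA f g (M.VAdag f) s := M.hVA f g hf hg s
    rw [← hPk] at h2
    simp only [hq, hDdef, hQ]
    linarith
  have hD0 : ∀ s, 0 ≤ D s := fun s => sub_nonneg.2 (hdom s)
  have h1g : 0 < 1 - M.gA := by linarith [M.hgA1]
  rcases h f hf with h | ⟨s, hs⟩
  · apply hne
    funext s
    have := maxPrinciple P hP M.gA 0 M.hgA0 M.hgA1 D (fun s => by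
      rw [hD s]; simp [hq, h s]) s
    rw [zero_div] at this
    exact le_antisymm (by simpa [hDdef] using this) (hdom s)
  · change _ < _ - _ * (⨆ s₀, ∑ s', P s₀ s' * q s') at hs
    set δ := ⨆ s₀, ∑ s', P s₀ s' * q s' with hδ
    have hle : ∀ s, ∑ s', P s s' * q s' ≤ δ := fun s =>
      le_ciSup (f := fun s₀ => ∑ s', P s₀ s' * q s') (Set.finite_range _).bddAbove s
    have hPD := maxPrinciple P hP M.gA δ M.hgA0 M.hgA1 (fun s => ∑ s', P s s' * D s') (fun s => by
      have : ∑ s', P s s' * D s' = ∑ s', P s s' * q s'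
          + M.gA * ∑ s', P s s' * ∑ t, P s' t * D t := by
        rw [Finset.mul_sum, ← Finset.sum_add_distrib]
        refine Finset.sum_congr rfl fun s' _ => ?_
        rw [hD s']
        ring
      have h5 := hle s
      change ∑ s', P s s' * D s' ≤ _
      linarith) s
    have h6 := mul_le_mul_of_nonneg_left hPD M.hgA0
    have h7 := hD s
    have h8 := hD0 s
    have h9 : M.gA / (1 - M.gA) * δ = M.gA * (δ / (1 - M.gA)) := by ring
    have h10 : q s = M.Q f' f s - M.VAdag f' s := rfl
    linarith
end
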